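/- Let F : Ω → ℝ^{n+1} be a hypersurface translating soliton with respect to the unit vector W. Let e ∈ ℝ^{n+1} be a unit vector such that f := ⟨ν, e⟩ > 0 on Ω and ⟨∇_g H, e⟩ := Σ_{i,j} g^{ij} ∂_j H ⟨∂_i F, e⟩ ≤ 0 on Ω. Then for every real p < 0 and every smooth compactly supported function η on Ω: ∫_Ω |A|² f^{p+1} η² √g dx + (|p|/2) ∫_Ω f^{p−1} |∇_g f|² η² √g dx ≤ (2/|p|) ∫_Ω f^{p+1} |∇_g η|² √g dx, where |∇_g φ|² = Σ_{i,j} g^{ij} ∂_i φ ∂_j φ and dx is Lebesgue measure on Ω. -/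

import Mathlib

open Real MeasureTheory

noncomputable section

/-- Partial derivative of a scalar function in the `i`-th coordinate direction. -/
def pd {n : ℕ} (i : Fin n) (φ : (Fin n → ℝ) → ℝ) (x : Fin n → ℝ) : ℝ :=
  fderiv ℝ φ x (Pi.single i 1)

/-- Induced metric `g_{ij} = ⟨∂_i F, ∂_j F⟩`. -/
def gmat {n m : ℕ} (F : (Fin n → ℝ) → (Fin m → ℝ)) (x : Fin n → ℝ) :
    Matrix (Fin n) (Fin n) ℝ :=
  Matrix.of fun i j => ∑ a, pd i (fun y => F y a) x * pd j (fun y => F y a) x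

/-- Inverse metric `g^{ij}`. -/
def ginv {n m : ℕ} (F : (Fin n → ℝ) → (Fin m → ℝ)) (x : Fin n → ℝ) :
    Matrix (Fin n) (Fin n) ℝ :=
  (gmat F x)⁻¹

/-- Laplace–Beltrami operator `Δ_g φ = g^{-1/2} Σ_{i,j} ∂_i (g^{1/2} g^{ij} ∂_j φ)`. -/
def lapB {n m : ℕ} (F : (Fin n → ℝ) → (Fin m → ℝ)) (φ : (Fin n → ℝ) → ℝ)
    (x : Fin n → ℝ) : ℝ :=
  (Real.sqrt (gmat F x).det)⁻¹ *
    ∑ i, ∑ j, pd i (fun y => Real.sqrt (gmat F y).det * ginv F y i j * pd j φ y) x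

/-- Mean curvature vector `H̄ = Δ_g F` (componentwise). -/
def Hvec {n m : ℕ} (F : (Fin n → ℝ) → (Fin m → ℝ)) (x : Fin n → ℝ) : Fin m → ℝ :=
  fun a => lapB F (fun y => F y a) x

/-- Tangential projection of an ambient vector `V` onto `span{∂_1 F(x), …, ∂_n F(x)}`:
`V^⊤ = Σ_{i,j} g^{ij} ⟨V, ∂_j F⟩ ∂_i F`. -/
def tproj {n m : ℕ} (F : (Fin n → ℝ) → (Fin m → ℝ)) (x : Fin n → ℝ)
    (V : Fin m → ℝ) : Fin m → ℝ :=
  fun a => ∑ i, ∑ j, ginv F x i j * (∑ b, V b * pd j (fun y => F y b) x)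
      * pd i (fun y => F y a) x

/-- `S(x) = ⟨F(x), W⟩`. -/
def Sfun {n m : ℕ} (F : (Fin n → ℝ) → (Fin m → ℝ)) (W : Fin m → ℝ)
    (x : Fin n → ℝ) : ℝ :=
  ∑ a, F x a * W a

/-- Second fundamental form `h_{ij} = ⟨∂_i ν, ∂_j F⟩`. -/
def sff {n m : ℕ} (F ν : (Fin n → ℝ) → (Fin m → ℝ)) (i j : Fin n) (x : Fin n → ℝ) : ℝ :=
  ∑ a, pd i (fun y => ν y a) x * pd j (fun y => F y a) x

/-- Scalar mean curvature `H = Σ_{i,j} g^{ij} h_{ij}`. -/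
def meanH {n m : ℕ} (F ν : (Fin n → ℝ) → (Fin m → ℝ)) (x : Fin n → ℝ) : ℝ :=
  ∑ i, ∑ j, ginv F x i j * sff F ν i j x

/-- `|A|² = Σ g^{ik} g^{jl} h_{ij} h_{kl}`. -/
def normA2 {n m : ℕ} (F ν : (Fin n → ℝ) → (Fin m → ℝ)) (x : Fin n → ℝ) : ℝ :=
  ∑ i, ∑ j, ∑ k, ∑ l, ginv F x i k * ginv F x j l * sff F ν i j x * sff F ν k l x

section PartialDerivatives

open scoped Matrix ContDiff

variable {n m : ℕ} {Ω : Set (Fin n → ℝ)} {x : Fin n → ℝ}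

/-- Componentwise partial derivative of a vector-valued function. -/
def pdVec (i : Fin n) (U : (Fin n → ℝ) → (Fin m → ℝ)) (x : Fin n → ℝ) : Fin m → ℝ :=
  fun a => pd i (fun y => U y a) x

theorem contDiffOn_pd (hΩ : IsOpen Ω) {φ : (Fin n → ℝ) → ℝ} (hφ : ContDiffOn ℝ ∞ φ Ω)
    (i : Fin n) : ContDiffOn ℝ ∞ (pd i φ) Ω :=
  (hφ.fderiv_of_isOpen hΩ (m := ∞) (by simp)).clm_apply contDiffOn_const

theorem contDiffOn_pdVec (hΩ : IsOpen Ω) {U : (Fin n → ℝ) → (Fin m → ℝ)}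
    (hU : ContDiffOn ℝ ∞ U Ω) (i : Fin n) : ContDiffOn ℝ ∞ (pdVec i U) Ω :=
  contDiffOn_pi.2 fun a => contDiffOn_pd hΩ (contDiffOn_pi.1 hU a) i

theorem ContDiffOn.differentiableAt_of_isOpen (hΩ : IsOpen Ω) {φ : (Fin n → ℝ) → ℝ}
    (hφ : ContDiffOn ℝ ∞ φ Ω) (hx : x ∈ Ω) : DifferentiableAt ℝ φ x :=
  (hφ.contDiffAt (hΩ.mem_nhds hx)).differentiableAt (by simp)

theorem pd_congr (hΩ : IsOpen Ω) {φ ψ : (Fin n → ℝ) → ℝ} (h : Set.EqOn φ ψ Ω) (hx : x ∈ Ω)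
    (i : Fin n) : pd i φ x = pd i ψ x := by
  rw [pd, pd, (h.eventuallyEq_of_mem (hΩ.mem_nhds hx)).fderiv_eq]

theorem pd_const (c : ℝ) (i : Fin n) : pd i (fun _ => c) x = 0 := by
  simp [pd]

theorem pd_mul {φ ψ : (Fin n → ℝ) → ℝ} (hφ : DifferentiableAt ℝ φ x)
    (hψ : DifferentiableAt ℝ ψ x) (i : Fin n) :
    pd i (fun y => φ y * ψ y) x = pd i φ x * ψ x + φ x * pd i ψ x := by
  simp only [pd, fderiv_fun_mul hφ hψ, add_apply,
    smul_apply, smul_eq_mul]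
  ring

theorem pd_sum {ι : Type*} {s : Finset ι} {φ : ι → (Fin n → ℝ) → ℝ}
    (hφ : ∀ k ∈ s, DifferentiableAt ℝ (φ k) x) (i : Fin n) :
    pd i (fun y => ∑ k ∈ s, φ k y) x = ∑ k ∈ s, pd i (φ k) x := by
  simp only [pd, fderiv_fun_sum hφ, sum_apply]

theorem pd_comp {u : ℝ → ℝ} {u' : ℝ} {φ : (Fin n → ℝ) → ℝ} (hu : HasDerivAt u u' (φ x))
    (hφ : DifferentiableAt ℝ φ x) (i : Fin n) :
    pd i (fun y => u (φ y)) x = u' * pd i φ x := by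
  have := hu.comp_hasFDerivAt x hφ.hasFDerivAt
  rw [pd, show (fun y => u (φ y)) = u ∘ φ from rfl, this.fderiv]
  simp [pd]

theorem pd_comm (hΩ : IsOpen Ω) {φ : (Fin n → ℝ) → ℝ} (hφ : ContDiffOn ℝ ∞ φ Ω) (hx : x ∈ Ω)
    (i j : Fin n) : pd i (pd j φ) x = pd j (pd i φ) x := by
  have h2 : ContDiffAt ℝ ∞ φ x := hφ.contDiffAt (hΩ.mem_nhds hx)
  have hd : DifferentiableAt ℝ (fderiv ℝ φ) x :=
    (h2.fderiv_right (m := ∞) (by simp)).differentiableAt (by simp)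
  have key : ∀ i j : Fin n, pd i (pd j φ) x
      = fderiv ℝ (fderiv ℝ φ) x (Pi.single i 1) (Pi.single j 1) := by
    intro i j
    have := (hd.hasFDerivAt.clm_apply (hasFDerivAt_const (Pi.single j (1 : ℝ)) x)).fderiv
    change fderiv ℝ (fun y => fderiv ℝ φ y (Pi.single j 1)) x (Pi.single i 1) = _
    rw [this]
    simp
  rw [key, key]
  exact h2.isSymmSndFDerivAt (by
    rw [minSmoothness_of_isRCLikeNormedField]
    exact WithTop.coe_le_coe.2 (le_top : (2 : ℕ∞) ≤ ⊤)) _ _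

theorem contDiffOn_dotProduct {U V : (Fin n → ℝ) → (Fin m → ℝ)} (hU : ContDiffOn ℝ ∞ U Ω)
    (hV : ContDiffOn ℝ ∞ V Ω) : ContDiffOn ℝ ∞ (fun y => U y ⬝ᵥ V y) Ω :=
  ContDiffOn.sum fun a _ => (contDiffOn_pi.1 hU a).mul (contDiffOn_pi.1 hV a)

theorem pd_dotProduct (hΩ : IsOpen Ω) {U V : (Fin n → ℝ) → (Fin m → ℝ)}
    (hU : ContDiffOn ℝ ∞ U Ω) (hV : ContDiffOn ℝ ∞ V Ω) (hx : x ∈ Ω) (i : Fin n) :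
    pd i (fun y => U y ⬝ᵥ V y) x = pdVec i U x ⬝ᵥ V x + U x ⬝ᵥ pdVec i V x := by
  have hU' a := (contDiffOn_pi.1 hU a).differentiableAt_of_isOpen hΩ hx
  have hV' a := (contDiffOn_pi.1 hV a).differentiableAt_of_isOpen hΩ hx
  simp only [dotProduct, pdVec, ← Finset.sum_add_distrib]
  rw [pd_sum fun a _ => (hU' a).fun_mul (hV' a)]
  exact Finset.sum_congr rfl fun a _ => pd_mul (hU' a) (hV' a) i

theorem pd_dotProduct_const (hΩ : IsOpen Ω) {U : (Fin n → ℝ) → (Fin m → ℝ)}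
    (hU : ContDiffOn ℝ ∞ U Ω) (hx : x ∈ Ω) (e : Fin m → ℝ) (i : Fin n) :
    pd i (fun y => U y ⬝ᵥ e) x = pdVec i U x ⬝ᵥ e := by
  rw [pd_dotProduct hΩ hU contDiffOn_const hx]
  simp [pdVec, pd_const, dotProduct]

theorem pdVec_comm (hΩ : IsOpen Ω) {U : (Fin n → ℝ) → (Fin m → ℝ)} (hU : ContDiffOn ℝ ∞ U Ω)
    (hx : x ∈ Ω) (i j : Fin n) : pdVec i (pdVec j U) x = pdVec j (pdVec i U) x :=
  funext fun a => pd_comm hΩ (contDiffOn_pi.1 hU a) hx i j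

theorem contDiffOn_det {k : ℕ} {G : (Fin n → ℝ) → Matrix (Fin k) (Fin k) ℝ}
    (hG : ∀ i j, ContDiffOn ℝ ∞ (fun y => G y i j) Ω) :
    ContDiffOn ℝ ∞ (fun y => (G y).det) Ω := by
  simp only [Matrix.det_apply']
  exact ContDiffOn.sum fun σ _ => contDiffOn_const.mul (contDiffOn_prod fun i _ => hG _ _)

theorem contDiffOn_inv_apply {k : ℕ} {G : (Fin n → ℝ) → Matrix (Fin k) (Fin k) ℝ}
    (hG : ∀ i j, ContDiffOn ℝ ∞ (fun y => G y i j) Ω) (h0 : ∀ y ∈ Ω, (G y).det ≠ 0)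
    (i j : Fin k) : ContDiffOn ℝ ∞ (fun y => (G y)⁻¹ i j) Ω := by
  simp only [Matrix.inv_def, Matrix.smul_apply, Ring.inverse_eq_inv', smul_eq_mul,
    Matrix.adjugate_apply]
  refine ((contDiffOn_det hG).inv h0).mul (contDiffOn_det fun a b => ?_)
  by_cases hab : a = j
  · subst hab
    simpa using contDiffOn_const
  · simpa [Matrix.updateRow_ne hab] using hG a b

/-- The Jacobi formula for the derivative of a determinant. -/
theorem pd_det {k : ℕ} {G : (Fin n → ℝ) → Matrix (Fin k) (Fin k) ℝ}
    (hG : ∀ i j, DifferentiableAt ℝ (fun y => G y i j) x) (h0 : (G x).det ≠ 0) (l : Fin n) :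
    pd l (fun y => (G y).det) x
      = (G x).det * ∑ i, ∑ j, (G x)⁻¹ i j * pd l (fun y => G y j i) x := by
  have hprod (σ : Equiv.Perm (Fin k)) : HasFDerivAt (fun y => ∏ i, G y (σ i) i) _ x :=
    HasFDerivAt.finsetProd (u := Finset.univ) fun i _ => (hG (σ i) i).hasFDerivAt
  have hcol (i : Fin k) : ((G x).updateCol i fun j => pd l (fun y => G y j i) x).det
      = (G x).det * ∑ j, (G x)⁻¹ i j * pd l (fun y => G y j i) x := by
    rw [← Matrix.cramer_apply, Matrix.cramer_eq_adjugate_mulVec, Matrix.inv_def,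
      Ring.inverse_eq_inv', Matrix.mulVec, dotProduct, Finset.mul_sum]
    refine Finset.sum_congr rfl fun j _ => ?_
    simp only [Matrix.smul_apply, smul_eq_mul]
    field_simp
  rw [Finset.mul_sum]
  rw [← Finset.sum_congr rfl fun i _ => hcol i]
  simp only [Matrix.det_apply']
  rw [pd_sum fun σ _ => (hprod σ).differentiableAt.const_mul _, Finset.sum_comm]
  refine Finset.sum_congr rfl fun σ _ => ?_
  rw [pd_mul (by fun_prop) (hprod σ).differentiableAt, pd_const, zero_mul, zero_add,
    ← Finset.mul_sum, pd, (hprod σ).fderiv, sum_apply]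
  congr 1
  refine Finset.sum_congr rfl fun i _ => ?_
  have herase : ∏ j ∈ Finset.univ.erase i,
      (G x).updateCol i (fun j => pd l (fun y => G y j i) x) (σ j) j
        = ∏ j ∈ Finset.univ.erase i, G x (σ j) j :=
    Finset.prod_congr rfl fun j hj => Matrix.updateCol_ne (Finset.ne_of_mem_erase hj)
  rw [← Finset.mul_prod_erase _ _ (Finset.mem_univ i), herase, Matrix.updateCol_self, mul_comm]
  rfl

end PartialDerivatives

section FramedHypersurface

open scoped Matrix ContDiff

variable {n m : ℕ}

/-- The coframe `∂^i F = ∑ⱼ g^{ij} ∂_j F` dual to the coordinate frame of an immersion. -/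
def coframe (F : (Fin n → ℝ) → (Fin m → ℝ)) (i : Fin n) (x : Fin n → ℝ) : Fin m → ℝ :=
  ∑ j, ginv F x i j • pdVec j F x

theorem dotProduct_coframe (F : (Fin n → ℝ) → (Fin m → ℝ)) (u : Fin m → ℝ) (i : Fin n)
    (x : Fin n → ℝ) : u ⬝ᵥ coframe F i x = ∑ j, ginv F x i j * (u ⬝ᵥ pdVec j F x) := by
  simp [coframe, dotProduct_sum, dotProduct_smul]

theorem gmat_apply (F : (Fin n → ℝ) → (Fin m → ℝ)) (x : Fin n → ℝ) (i j : Fin n) :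
    gmat F x i j = pdVec i F x ⬝ᵥ pdVec j F x := rfl

theorem ginv_comm (F : (Fin n → ℝ) → (Fin m → ℝ)) (x : Fin n → ℝ) (i j : Fin n) :
    ginv F x i j = ginv F x j i := by
  have h : (gmat F x)ᵀ = gmat F x :=
    Matrix.ext fun i j => by rw [Matrix.transpose_apply, gmat_apply, gmat_apply, dotProduct_comm]
  rw [ginv, ← Matrix.transpose_apply (gmat F x)⁻¹, Matrix.transpose_nonsing_inv, h]

/-- A smooth immersed hypersurface over an open set, together with a smooth unit normal field. -/
structure IsFramedHypersurface (Ω : Set (Fin n → ℝ))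
    (F ν : (Fin n → ℝ) → (Fin (n + 1) → ℝ)) : Prop where
  isOpen : IsOpen Ω
  contDiffOn : ContDiffOn ℝ ∞ F Ω
  contDiffOn_normal : ContDiffOn ℝ ∞ ν Ω
  posDef : ∀ x ∈ Ω, (gmat F x).PosDef
  normal_self : ∀ x ∈ Ω, ν x ⬝ᵥ ν x = 1
  normal_tangent : ∀ x ∈ Ω, ∀ i, ν x ⬝ᵥ pdVec i F x = 0

namespace IsFramedHypersurface

variable {Ω : Set (Fin n → ℝ)} {F ν : (Fin n → ℝ) → (Fin (n + 1) → ℝ)} {x : Fin n → ℝ}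

theorem det_pos (h : IsFramedHypersurface Ω F ν) (hx : x ∈ Ω) : 0 < (gmat F x).det :=
  (h.posDef x hx).det_pos

theorem sqrt_det_pos (h : IsFramedHypersurface Ω F ν) (hx : x ∈ Ω) : 0 < √(gmat F x).det :=
  Real.sqrt_pos.2 (h.det_pos hx)

theorem coframe_dotProduct_frame (h : IsFramedHypersurface Ω F ν) (hx : x ∈ Ω) (i j : Fin n) :
    coframe F i x ⬝ᵥ pdVec j F x = if i = j then 1 else 0 := by
  have := congr_fun₂ (Matrix.nonsing_inv_mul (gmat F x) (h.det_pos hx).ne'.isUnit) i j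
  rw [Matrix.one_apply, Matrix.mul_apply] at this
  rw [← this, dotProduct_comm, dotProduct_coframe]
  exact Finset.sum_congr rfl fun k _ => by rw [gmat_apply, dotProduct_comm (pdVec j F x)]; rfl

theorem coframe_dotProduct_coframe (h : IsFramedHypersurface Ω F ν) (hx : x ∈ Ω) (i j : Fin n) :
    coframe F i x ⬝ᵥ coframe F j x = ginv F x i j := by
  simp [dotProduct_coframe, h.coframe_dotProduct_frame hx, ginv_comm F x j i]

theorem contDiffOn_gmat (h : IsFramedHypersurface Ω F ν) (i j : Fin n) :
    ContDiffOn ℝ ∞ (fun y => gmat F y i j) Ω :=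
  contDiffOn_dotProduct (contDiffOn_pdVec h.isOpen h.contDiffOn i)
    (contDiffOn_pdVec h.isOpen h.contDiffOn j)

theorem contDiffOn_ginv (h : IsFramedHypersurface Ω F ν) (i j : Fin n) :
    ContDiffOn ℝ ∞ (fun y => ginv F y i j) Ω :=
  contDiffOn_inv_apply h.contDiffOn_gmat (fun _ hy => (h.det_pos hy).ne') i j

theorem contDiffOn_sqrt_det (h : IsFramedHypersurface Ω F ν) :
    ContDiffOn ℝ ∞ (fun y => √(gmat F y).det) Ω :=
  (contDiffOn_det h.contDiffOn_gmat).sqrt fun _ hy => (h.det_pos hy).ne'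

theorem contDiffOn_frame (h : IsFramedHypersurface Ω F ν) (i : Fin n) :
    ContDiffOn ℝ ∞ (pdVec i F) Ω :=
  contDiffOn_pdVec h.isOpen h.contDiffOn i

theorem contDiffOn_pdVec_normal (h : IsFramedHypersurface Ω F ν) (i : Fin n) :
    ContDiffOn ℝ ∞ (pdVec i ν) Ω :=
  contDiffOn_pdVec h.isOpen h.contDiffOn_normal i

theorem contDiffOn_coframe (h : IsFramedHypersurface Ω F ν) (i : Fin n) :
    ContDiffOn ℝ ∞ (coframe F i) Ω :=
  ContDiffOn.sum fun j _ => (h.contDiffOn_ginv i j).smul (h.contDiffOn_frame j)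

/-- Expansion of the Euclidean inner product in the frame, its dual coframe and the normal. -/
theorem dotProduct_eq (h : IsFramedHypersurface Ω F ν) (hx : x ∈ Ω) (u v : Fin (n + 1) → ℝ) :
    u ⬝ᵥ v = ∑ k, (u ⬝ᵥ coframe F k x) * (v ⬝ᵥ pdVec k F x) + (u ⬝ᵥ ν x) * (v ⬝ᵥ ν x) := by
  let P : Matrix (Fin n ⊕ Unit) (Fin (n + 1)) ℝ :=
    Matrix.of (Sum.elim (fun i => coframe F i x) fun _ => ν x)
  let Q : Matrix (Fin (n + 1)) (Fin n ⊕ Unit) ℝ :=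
    (Matrix.of (Sum.elim (fun i => pdVec i F x) fun _ => ν x))ᵀ
  have hPQ : P * Q = 1 := by
    have hν (i : Fin n) : coframe F i x ⬝ᵥ ν x = 0 := by
      simp [dotProduct_comm _ (ν x), dotProduct_coframe, h.normal_tangent x hx]
    ext i j
    change P i ⬝ᵥ Qᵀ j = _
    rcases i with i | i <;> rcases j with j | j
    · simpa [Matrix.one_apply] using! h.coframe_dotProduct_frame hx i j
    · simpa using! hν i
    · simpa using! h.normal_tangent x hx j
    · simpa using! h.normal_self x hx
  have hQP : Q * P = 1 := (Matrix.mul_eq_one_comm_of_card_eq _ _ _ (by simp)).1 hPQ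
  calc u ⬝ᵥ v = v ⬝ᵥ (Q * P) *ᵥ u := by rw [hQP, Matrix.one_mulVec, dotProduct_comm]
    _ = v ᵥ* Q ⬝ᵥ P *ᵥ u := by rw [← Matrix.mulVec_mulVec, Matrix.dotProduct_mulVec]
    _ = _ := by
      rw [dotProduct, Fintype.sum_sum_type, Fintype.sum_unique (ι := Unit)]
      congr 1
      · refine Finset.sum_congr rfl fun k _ => ?_
        rw [mul_comm, dotProduct_comm u]
        rfl
      · rw [mul_comm, dotProduct_comm u]
        rfl

theorem pdVec_normal_dotProduct_normal (h : IsFramedHypersurface Ω F ν) (hx : x ∈ Ω)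
    (i : Fin n) : pdVec i ν x ⬝ᵥ ν x = 0 := by
  have h1 := pd_dotProduct h.isOpen h.contDiffOn_normal h.contDiffOn_normal hx i
  rw [pd_congr h.isOpen (ψ := fun _ => 1) (fun y hy => h.normal_self y hy) hx, pd_const,
    dotProduct_comm (ν x)] at h1
  linarith

theorem pdVec_normal_dotProduct (h : IsFramedHypersurface Ω F ν) (hx : x ∈ Ω) (i : Fin n)
    (v : Fin (n + 1) → ℝ) :
    pdVec i ν x ⬝ᵥ v = ∑ k, (pdVec i ν x ⬝ᵥ coframe F k x) * (v ⬝ᵥ pdVec k F x) := by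
  rw [h.dotProduct_eq hx, h.pdVec_normal_dotProduct_normal hx, zero_mul, add_zero]

theorem pdVec_normal_dotProduct' (h : IsFramedHypersurface Ω F ν) (hx : x ∈ Ω) (i : Fin n)
    (v : Fin (n + 1) → ℝ) :
    pdVec i ν x ⬝ᵥ v = ∑ k, (v ⬝ᵥ coframe F k x) * (pdVec i ν x ⬝ᵥ pdVec k F x) := by
  rw [dotProduct_comm, h.dotProduct_eq hx, h.pdVec_normal_dotProduct_normal hx, mul_zero,
    add_zero]

/-- Symmetry of the second fundamental form. -/
theorem sff_symm (h : IsFramedHypersurface Ω F ν) (hx : x ∈ Ω) (i j : Fin n) :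
    pdVec i ν x ⬝ᵥ pdVec j F x = pdVec j ν x ⬝ᵥ pdVec i F x := by
  have key (i j : Fin n) :
      pdVec i ν x ⬝ᵥ pdVec j F x + ν x ⬝ᵥ pdVec i (pdVec j F) x = 0 := by
    rw [← pd_dotProduct h.isOpen h.contDiffOn_normal (h.contDiffOn_frame j) hx,
      pd_congr h.isOpen (ψ := fun _ => 0) (fun y hy => h.normal_tangent y hy j) hx, pd_const]
  have h1 := key i j
  rw [pdVec_comm h.isOpen h.contDiffOn hx] at h1
  linarith [key j i]

/-- The Codazzi equation. -/
theorem codazzi (h : IsFramedHypersurface Ω F ν) (hx : x ∈ Ω) (i j k : Fin n) :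
    pdVec i (pdVec j ν) x ⬝ᵥ pdVec k F x + pdVec j ν x ⬝ᵥ pdVec i (pdVec k F) x
      = pdVec i (pdVec k ν) x ⬝ᵥ pdVec j F x + pdVec k ν x ⬝ᵥ pdVec i (pdVec j F) x := by
  rw [← pd_dotProduct h.isOpen (h.contDiffOn_pdVec_normal j) (h.contDiffOn_frame k) hx,
    ← pd_dotProduct h.isOpen (h.contDiffOn_pdVec_normal k) (h.contDiffOn_frame j) hx]
  exact pd_congr h.isOpen (fun y hy => h.sff_symm hy j k) hx i

/-- The shape operator is self-adjoint. -/
theorem shape_symm (h : IsFramedHypersurface Ω F ν) (hx : x ∈ Ω) (u v : Fin (n + 1) → ℝ) :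
    ∑ j, (u ⬝ᵥ coframe F j x) * (pdVec j ν x ⬝ᵥ v)
      = ∑ j, (v ⬝ᵥ coframe F j x) * (pdVec j ν x ⬝ᵥ u) := by
  simp only [h.pdVec_normal_dotProduct' hx _ v, h.pdVec_normal_dotProduct' hx _ u,
    Finset.mul_sum]
  rw [Finset.sum_comm]
  refine Finset.sum_congr rfl fun k _ => Finset.sum_congr rfl fun j _ => ?_
  rw [h.sff_symm hx j k]
  ring

theorem pdVec_coframe_dotProduct_frame (h : IsFramedHypersurface Ω F ν) (hx : x ∈ Ω)
    (l i j : Fin n) :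
    pdVec l (coframe F i) x ⬝ᵥ pdVec j F x = -(coframe F i x ⬝ᵥ pdVec l (pdVec j F) x) := by
  have h1 := pd_dotProduct h.isOpen (h.contDiffOn_coframe i) (h.contDiffOn_frame j) hx l
  rw [pd_congr h.isOpen (fun y hy => h.coframe_dotProduct_frame hy i j) hx, pd_const] at h1
  linarith

theorem pd_ginv (h : IsFramedHypersurface Ω F ν) (hx : x ∈ Ω) (l i j : Fin n) :
    pd l (fun y => ginv F y i j) x
      = -(∑ b, ginv F x j b * (coframe F i x ⬝ᵥ pdVec l (pdVec b F) x)
        + ∑ b, ginv F x i b * (coframe F j x ⬝ᵥ pdVec l (pdVec b F) x)) := by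
  rw [← pd_congr h.isOpen (fun y hy => h.coframe_dotProduct_coframe hy i j) hx,
    pd_dotProduct h.isOpen (h.contDiffOn_coframe i) (h.contDiffOn_coframe j) hx,
    dotProduct_comm (coframe F i x), dotProduct_coframe, dotProduct_coframe]
  simp only [h.pdVec_coframe_dotProduct_frame hx, mul_neg, Finset.sum_neg_distrib]
  ring

theorem pd_sqrt_det (h : IsFramedHypersurface Ω F ν) (hx : x ∈ Ω) (l : Fin n) :
    pd l (fun y => √(gmat F y).det) x
      = √(gmat F x).det * ∑ i, coframe F i x ⬝ᵥ pdVec l (pdVec i F) x := by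
  have hd := (h.det_pos hx).ne'
  have hdiff := (contDiffOn_det h.contDiffOn_gmat).differentiableAt_of_isOpen h.isOpen hx
  rw [pd_comp (Real.hasDerivAt_sqrt hd) hdiff, pd_det (fun i j =>
    (h.contDiffOn_gmat i j).differentiableAt_of_isOpen h.isOpen hx) hd]
  have hsum : ∑ i, ∑ j, (gmat F x)⁻¹ i j * pd l (fun y => gmat F y j i) x
      = 2 * ∑ i, coframe F i x ⬝ᵥ pdVec l (pdVec i F) x := by
    have h1 (i j : Fin n) : pd l (fun y => gmat F y j i) x
        = pdVec l (pdVec j F) x ⬝ᵥ pdVec i F x + pdVec j F x ⬝ᵥ pdVec l (pdVec i F) x :=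
      pd_dotProduct h.isOpen (h.contDiffOn_frame j) (h.contDiffOn_frame i) hx l
    simp only [h1, mul_add, Finset.sum_add_distrib, two_mul]
    congr 1
    · rw [Finset.sum_comm]
      refine Finset.sum_congr rfl fun j _ => ?_
      rw [dotProduct_comm, dotProduct_coframe]
      exact Finset.sum_congr rfl fun i _ => by rw [← ginv_comm]; rfl
    · refine Finset.sum_congr rfl fun i _ => ?_
      rw [dotProduct_comm, dotProduct_coframe]
      exact Finset.sum_congr rfl fun j _ => by rw [dotProduct_comm]; rfl
  rw [hsum]
  have hs := Real.mul_self_sqrt (h.det_pos hx).le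
  have hs0 := (h.sqrt_det_pos hx).ne'
  field_simp
  linear_combination (-∑ i, coframe F i x ⬝ᵥ pdVec l (pdVec i F) x) * hs

/-- The trace `∑ g^{ij} ∂_i ∂_j U` of the second derivatives of a vector field. -/
def metricTrace (F U : (Fin n → ℝ) → (Fin m → ℝ)) (x : Fin n → ℝ) : Fin m → ℝ :=
  ∑ i, ∑ j, ginv F x i j • pdVec i (pdVec j U) x

theorem metricTrace_dotProduct (F U : (Fin n → ℝ) → (Fin m → ℝ)) (x : Fin n → ℝ)
    (v : Fin m → ℝ) :
    metricTrace F U x ⬝ᵥ v = ∑ i, ∑ j, ginv F x i j * (pdVec i (pdVec j U) x ⬝ᵥ v) := by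
  simp [metricTrace, sum_dotProduct, smul_dotProduct]

theorem sum_pd_sqrt_det_mul_ginv (h : IsFramedHypersurface Ω F ν) (hx : x ∈ Ω) (j : Fin n) :
    ∑ i, pd i (fun y => √(gmat F y).det * ginv F y i j) x
      = -(√(gmat F x).det * (metricTrace F F x ⬝ᵥ coframe F j x)) := by
  have h1 (i : Fin n) := pd_mul (h.contDiffOn_sqrt_det.differentiableAt_of_isOpen h.isOpen hx)
    ((h.contDiffOn_ginv i j).differentiableAt_of_isOpen h.isOpen hx) i
  have h2 : ∑ i, ∑ b, ginv F x j b * (coframe F i x ⬝ᵥ pdVec i (pdVec b F) x)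
      = ∑ i, (∑ b, coframe F b x ⬝ᵥ pdVec i (pdVec b F) x) * ginv F x i j := by
    rw [Finset.sum_comm]
    refine Finset.sum_congr rfl fun b _ => ?_
    rw [Finset.sum_mul]
    refine Finset.sum_congr rfl fun i _ => ?_
    rw [pdVec_comm h.isOpen h.contDiffOn hx, ginv_comm F x j b, mul_comm]
  have h3 : ∑ i, ∑ b, ginv F x i b * (coframe F j x ⬝ᵥ pdVec i (pdVec b F) x)
      = metricTrace F F x ⬝ᵥ coframe F j x := by
    simp only [metricTrace_dotProduct, dotProduct_comm (coframe F j x)]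
  simp only [h1, h.pd_sqrt_det hx, h.pd_ginv hx, Finset.sum_add_distrib, mul_assoc,
    ← Finset.mul_sum, Finset.sum_neg_distrib, h3, h2]
  ring

theorem meanH_eq (F ν : (Fin n → ℝ) → (Fin m → ℝ)) (y : Fin n → ℝ) :
    meanH F ν y = ∑ i, pdVec i ν y ⬝ᵥ coframe F i y := by
  simp only [meanH, dotProduct_coframe]
  rfl

theorem pd_meanH (h : IsFramedHypersurface Ω F ν) (hx : x ∈ Ω) (k : Fin n) :
    pd k (meanH F ν) x = ∑ i, pdVec k (pdVec i ν) x ⬝ᵥ coframe F i x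
      - ∑ i, ∑ j, ginv F x i j * (pdVec j ν x ⬝ᵥ pdVec k (pdVec i F) x) := by
  rw [funext (meanH_eq F ν), pd_sum fun i _ => (contDiffOn_dotProduct (h.contDiffOn_pdVec_normal i)
    (h.contDiffOn_coframe i)).differentiableAt_of_isOpen h.isOpen hx]
  simp only [fun i => pd_dotProduct h.isOpen (h.contDiffOn_pdVec_normal i)
    (h.contDiffOn_coframe i) hx k, Finset.sum_add_distrib, sub_eq_add_neg]
  congr 1
  simp only [h.pdVec_normal_dotProduct hx _ (pdVec k (coframe F _) x),
    h.pdVec_coframe_dotProduct_frame hx, mul_neg, Finset.sum_neg_distrib, neg_inj]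
  rw [Finset.sum_comm]
  refine Finset.sum_congr rfl fun l _ => ?_
  have := h.shape_symm hx (coframe F l x) (pdVec k (pdVec l F) x)
  simp only [h.coframe_dotProduct_coframe hx] at this
  rw [this]
  refine Finset.sum_congr rfl fun i _ => ?_
  rw [dotProduct_comm (coframe F i x), mul_comm]

theorem metricTrace_normal_dotProduct_frame (h : IsFramedHypersurface Ω F ν) (hx : x ∈ Ω)
    (k : Fin n) :
    metricTrace F ν x ⬝ᵥ pdVec k F x
      = pd k (meanH F ν) x + pdVec k ν x ⬝ᵥ metricTrace F F x := by
  have h1 (i j : Fin n) : pdVec i (pdVec j ν) x ⬝ᵥ pdVec k F x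
      = pdVec k (pdVec i ν) x ⬝ᵥ pdVec j F x + pdVec i (pdVec j F) x ⬝ᵥ pdVec k ν x
        - pdVec j ν x ⬝ᵥ pdVec k (pdVec i F) x := by
    rw [pdVec_comm h.isOpen h.contDiffOn_normal hx k i, pdVec_comm h.isOpen h.contDiffOn hx k i,
      dotProduct_comm _ (pdVec k ν x)]
    linarith [h.codazzi hx i j k]
  rw [h.pd_meanH hx, dotProduct_comm (pdVec k ν x), metricTrace_dotProduct,
    metricTrace_dotProduct]
  simp only [h1, mul_add, mul_sub, Finset.sum_add_distrib, Finset.sum_sub_distrib,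
    dotProduct_coframe]
  ring

theorem normA2_eq (h : IsFramedHypersurface Ω F ν) (hx : x ∈ Ω) :
    normA2 F ν x = ∑ i, ∑ j, ginv F x i j * (pdVec i ν x ⬝ᵥ pdVec j ν x) := by
  have h1 (i k : Fin n) : pdVec i ν x ⬝ᵥ pdVec k ν x
      = ∑ j, ∑ l, ginv F x j l * sff F ν i j x * sff F ν k l x := by
    rw [h.pdVec_normal_dotProduct' hx]
    refine Finset.sum_congr rfl fun j _ => ?_
    rw [dotProduct_coframe, Finset.sum_mul]
    exact Finset.sum_congr rfl fun l _ => mul_right_comm _ _ _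
  simp only [normA2, h1, Finset.mul_sum]
  refine Finset.sum_congr rfl fun i _ => ?_
  rw [Finset.sum_comm]
  refine Finset.sum_congr rfl fun k _ => Finset.sum_congr rfl fun j _ =>
    Finset.sum_congr rfl fun l _ => ?_
  ring

theorem metricTrace_normal_dotProduct_normal (h : IsFramedHypersurface Ω F ν) (hx : x ∈ Ω) :
    metricTrace F ν x ⬝ᵥ ν x = -normA2 F ν x := by
  have h1 (i j : Fin n) :
      pdVec i (pdVec j ν) x ⬝ᵥ ν x = -(pdVec i ν x ⬝ᵥ pdVec j ν x) := by
    have h2 := pd_dotProduct h.isOpen (h.contDiffOn_pdVec_normal j) h.contDiffOn_normal hx i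
    rw [pd_congr h.isOpen (ψ := fun _ => 0)
      (fun y hy => h.pdVec_normal_dotProduct_normal hy j) hx, pd_const,
      dotProduct_comm (pdVec j ν x)] at h2
    linarith
  simp only [metricTrace_dotProduct, h.normA2_eq hx, h1, mul_neg, Finset.sum_neg_distrib]

/-- Flux density `√g ∑ⱼ g^{ij} ∂_j ⟨ν, e⟩` of the gradient of a component of the normal. -/
def normalFlux (F ν : (Fin n → ℝ) → (Fin m → ℝ)) (e : Fin m → ℝ) (i : Fin n)
    (y : Fin n → ℝ) : ℝ :=
  ∑ j, √(gmat F y).det * ginv F y i j * (pdVec j ν y ⬝ᵥ e)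

theorem contDiffOn_normalFlux (h : IsFramedHypersurface Ω F ν) (e : Fin (n + 1) → ℝ)
    (i : Fin n) : ContDiffOn ℝ ∞ (normalFlux F ν e i) Ω :=
  ContDiffOn.sum fun j _ => (h.contDiffOn_sqrt_det.mul (h.contDiffOn_ginv i j)).mul
    (contDiffOn_dotProduct (h.contDiffOn_pdVec_normal j) contDiffOn_const)

/-- The Laplacian of a component of the normal: `Δ⟨ν, e⟩ = ⟨∇H, e⟩ - |A|² ⟨ν, e⟩`. -/
theorem sum_pd_normalFlux (h : IsFramedHypersurface Ω F ν) (hx : x ∈ Ω)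
    (e : Fin (n + 1) → ℝ) :
    ∑ i, pd i (normalFlux F ν e i) x
      = √(gmat F x).det * (∑ k, (e ⬝ᵥ coframe F k x) * pd k (meanH F ν) x
        - normA2 F ν x * (ν x ⬝ᵥ e)) := by
  have hd (i j : Fin n) : DifferentiableAt ℝ (fun y => √(gmat F y).det * ginv F y i j) x :=
    (h.contDiffOn_sqrt_det.mul (h.contDiffOn_ginv i j)).differentiableAt_of_isOpen h.isOpen hx
  have hdν (j : Fin n) : DifferentiableAt ℝ (fun y => pdVec j ν y ⬝ᵥ e) x :=
    (contDiffOn_dotProduct (h.contDiffOn_pdVec_normal j)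
      contDiffOn_const).differentiableAt_of_isOpen h.isOpen hx
  have h1 (i : Fin n) : pd i (normalFlux F ν e i) x
      = ∑ j, (pd i (fun y => √(gmat F y).det * ginv F y i j) x * (pdVec j ν x ⬝ᵥ e)
        + √(gmat F x).det * (ginv F x i j * (pdVec i (pdVec j ν) x ⬝ᵥ e))) := by
    unfold normalFlux
    rw [pd_sum fun j _ => (hd i j).fun_mul (hdν j)]
    refine Finset.sum_congr rfl fun j _ => ?_
    rw [pd_mul (hd i j) (hdν j), pd_dotProduct_const h.isOpen (h.contDiffOn_pdVec_normal j) hx,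
      mul_assoc]
  have h2 : ∑ i, ∑ j, pd i (fun y => √(gmat F y).det * ginv F y i j) x * (pdVec j ν x ⬝ᵥ e)
      = -(√(gmat F x).det *
        ∑ j, (metricTrace F F x ⬝ᵥ coframe F j x) * (pdVec j ν x ⬝ᵥ e)) := by
    rw [Finset.sum_comm]
    simp only [← Finset.sum_mul, h.sum_pd_sqrt_det_mul_ginv hx]
    simp only [neg_mul, mul_assoc, Finset.sum_neg_distrib, ← Finset.mul_sum]
  have h3 : ∑ i, ∑ j, ginv F x i j * (pdVec i (pdVec j ν) x ⬝ᵥ e)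
      = ∑ k, (e ⬝ᵥ coframe F k x) * pd k (meanH F ν) x
        + ∑ k, (e ⬝ᵥ coframe F k x) * (pdVec k ν x ⬝ᵥ metricTrace F F x)
        - normA2 F ν x * (ν x ⬝ᵥ e) := by
    rw [← metricTrace_dotProduct, dotProduct_comm, h.dotProduct_eq hx,
      h.metricTrace_normal_dotProduct_normal hx, dotProduct_comm e (ν x)]
    simp only [h.metricTrace_normal_dotProduct_frame hx, mul_add, Finset.sum_add_distrib]
    ring
  simp only [h1, Finset.sum_add_distrib, ← Finset.mul_sum, h2, h3,
    h.shape_symm hx (metricTrace F F x) e]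
  ring

end IsFramedHypersurface

end FramedHypersurface

section Divergence

open scoped ContDiff

variable {n : ℕ} {Ω : Set (Fin n → ℝ)} {ζ : (Fin n → ℝ) → ℝ}

theorem integrable_of_continuousOn_of_tsupport (hζ : HasCompactSupport ζ) (hζΩ : tsupport ζ ⊆ Ω)
    {ψ : (Fin n → ℝ) → ℝ} (hψ : ContinuousOn ψ Ω) (h0 : ∀ x ∉ tsupport ζ, ψ x = 0) :
    Integrable ψ :=
  (integrableOn_iff_integrable_of_support_subset fun x hx => by_contra fun hx' => hx (h0 x hx')).1
    ((hψ.mono hζΩ).integrableOn_compact hζ)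

theorem pd_eq_zero_of_notMem_tsupport {x : Fin n → ℝ} (hx : x ∉ tsupport ζ) (i : Fin n) :
    pd i ζ x = 0 := by
  rw [pd, fderiv_of_notMem_tsupport ℝ hx, zero_apply]

/-- The divergence theorem for a compactly supported multiple of a smooth vector field. -/
theorem setIntegral_divergence_eq_zero (hΩ : IsOpen Ω) (hζ : ContDiff ℝ ∞ ζ)
    (hζc : HasCompactSupport ζ) (hζΩ : tsupport ζ ⊆ Ω) {Y : Fin n → (Fin n → ℝ) → ℝ}
    (hY : ∀ i, ContDiffOn ℝ ∞ (Y i) Ω) :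
    IntegrableOn (fun x => ∑ i, (pd i ζ x * Y i x + ζ x * pd i (Y i) x)) Ω ∧
      ∫ x in Ω, ∑ i, (pd i ζ x * Y i x + ζ x * pd i (Y i) x) = 0 := by
  have hζ0 {x} (hx : x ∉ tsupport ζ) : ζ x = 0 := image_eq_zero_of_notMem_tsupport hx
  have h1 (i : Fin n) : Integrable fun x => pd i ζ x * Y i x :=
    integrable_of_continuousOn_of_tsupport hζc hζΩ
      ((contDiffOn_pd hΩ hζ.contDiffOn i).mul (hY i)).continuousOn
      fun x hx => by rw [pd_eq_zero_of_notMem_tsupport hx, zero_mul]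
  have h2 (i : Fin n) : Integrable fun x => ζ x * pd i (Y i) x :=
    integrable_of_continuousOn_of_tsupport hζc hζΩ
      (hζ.contDiffOn.mul (contDiffOn_pd hΩ (hY i) i)).continuousOn
      fun x hx => by rw [hζ0 hx, zero_mul]
  have h3 (i : Fin n) : Integrable fun x => ζ x * Y i x :=
    integrable_of_continuousOn_of_tsupport hζc hζΩ (hζ.contDiffOn.mul (hY i)).continuousOn
      fun x hx => by rw [hζ0 hx, zero_mul]
  have h12 (i : Fin n) : Integrable fun x => pd i ζ x * Y i x + ζ x * pd i (Y i) x :=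
    (h1 i).add (h2 i)
  have h4 (i : Fin n) : ∫ x, (pd i ζ x * Y i x + ζ x * pd i (Y i) x) = 0 := by
    have := integral_mul_fderiv_eq_neg_fderiv_mul_of_integrable (h1 i) (h2 i) (h3 i)
      (fun x _ => hζ.differentiable (by simp) x)
      (fun x hx => (hY i).differentiableAt_of_isOpen hΩ (hζΩ hx))
    rw [integral_add (h1 i) (h2 i)]
    simp only [pd]
    rw [this, add_neg_cancel]
  refine ⟨(integrable_finsetSum _ fun i _ => h12 i).integrableOn, ?_⟩
  rw [setIntegral_eq_integral_of_forall_compl_eq_zero,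
    integral_finsetSum _ fun i _ => h12 i]
  · exact Finset.sum_eq_zero fun i _ => h4 i
  · intro x hx
    have hx' : x ∉ tsupport ζ := fun hx' => hx (hζΩ hx')
    simp [pd_eq_zero_of_notMem_tsupport hx', hζ0 hx']

end Divergence

section CotangentForm

open scoped Matrix ContDiff

variable {n m : ℕ}

/-- The inner product of covectors induced by the metric, `∑ g^{ij} α_i β_j`. -/
def cometric (F : (Fin n → ℝ) → (Fin m → ℝ)) (x : Fin n → ℝ) (α β : Fin n → ℝ) : ℝ :=
  ∑ i, ∑ j, ginv F x i j * α i * β j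

namespace IsFramedHypersurface

variable {Ω : Set (Fin n → ℝ)} {F ν : (Fin n → ℝ) → (Fin (n + 1) → ℝ)} {x : Fin n → ℝ}

theorem cometric_eq_dotProduct (h : IsFramedHypersurface Ω F ν) (hx : x ∈ Ω)
    (α β : Fin n → ℝ) :
    cometric F x α β = (∑ i, α i • coframe F i x) ⬝ᵥ ∑ j, β j • coframe F j x := by
  simp only [cometric, sum_dotProduct, dotProduct_sum, smul_dotProduct, dotProduct_smul,
    h.coframe_dotProduct_coframe hx, smul_eq_mul, Finset.mul_sum]
  rw [Finset.sum_comm]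
  exact Finset.sum_congr rfl fun i _ => Finset.sum_congr rfl fun j _ => by ring

theorem cometric_young (h : IsFramedHypersurface Ω F ν) (hx : x ∈ Ω) (α β : Fin n → ℝ)
    (s t : ℝ) :
    2 * (s * t) * cometric F x α β ≤ s ^ 2 * cometric F x α α + t ^ 2 * cometric F x β β := by
  simp only [h.cometric_eq_dotProduct hx]
  generalize ∑ i, α i • coframe F i x = u
  generalize ∑ i, β i • coframe F i x = v
  have h0 : 0 ≤ (s • u - t • v) ⬝ᵥ (s • u - t • v) :=
    Finset.sum_nonneg fun a _ => mul_self_nonneg _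
  simp only [sub_dotProduct, dotProduct_sub, smul_dotProduct, dotProduct_smul, smul_eq_mul,
    dotProduct_comm v u] at h0
  linarith

theorem contDiffOn_cometric (h : IsFramedHypersurface Ω F ν) {α β : (Fin n → ℝ) → Fin n → ℝ}
    (hα : ∀ i, ContDiffOn ℝ ∞ (fun y => α y i) Ω) (hβ : ∀ i, ContDiffOn ℝ ∞ (fun y => β y i) Ω) :
    ContDiffOn ℝ ∞ (fun y => cometric F y (α y) (β y)) Ω :=
  ContDiffOn.sum fun i _ => ContDiffOn.sum fun j _ =>
    ((h.contDiffOn_ginv i j).mul (hα i)).mul (hβ j)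

theorem contDiffOn_normA2 (h : IsFramedHypersurface Ω F ν) :
    ContDiffOn ℝ ∞ (normA2 F ν) Ω := by
  have hs (i j : Fin n) : ContDiffOn ℝ ∞ (sff F ν i j) Ω :=
    contDiffOn_dotProduct (h.contDiffOn_pdVec_normal i) (h.contDiffOn_frame j)
  exact ContDiffOn.sum fun i _ => ContDiffOn.sum fun j _ => ContDiffOn.sum fun k _ =>
    ContDiffOn.sum fun l _ => (((h.contDiffOn_ginv i k).mul (h.contDiffOn_ginv j l)).mul
      (hs i j)).mul (hs k l)

theorem sum_mul_normalFlux (h : IsFramedHypersurface Ω F ν) (hx : x ∈ Ω)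
    (e : Fin (n + 1) → ℝ) (α : Fin n → ℝ) :
    ∑ i, α i * normalFlux F ν e i x
      = √(gmat F x).det * cometric F x α fun j => pd j (fun y => ν y ⬝ᵥ e) x := by
  simp only [normalFlux, cometric, Finset.mul_sum,
    pd_dotProduct_const h.isOpen h.contDiffOn_normal hx]
  exact Finset.sum_congr rfl fun i _ => Finset.sum_congr rfl fun j _ => by ring

/-- Pointwise form of the test-function inequality, up to a divergence term. -/
theorem test_inequality_pointwise (h : IsFramedHypersurface Ω F ν) (hx : x ∈ Ω)
    {e : Fin (n + 1) → ℝ} (hf : 0 < ν x ⬝ᵥ e)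
    (hH : ∑ k, (e ⬝ᵥ coframe F k x) * pd k (meanH F ν) x ≤ 0) {p : ℝ} (hp : p < 0)
    {η : (Fin n → ℝ) → ℝ} (hη : DifferentiableAt ℝ η x) :
    normA2 F ν x * (ν x ⬝ᵥ e) ^ (p + 1) * η x ^ 2 * √(gmat F x).det
      + |p| / 2 * ((ν x ⬝ᵥ e) ^ (p - 1)
          * cometric F x (fun i => pd i (fun y => ν y ⬝ᵥ e) x)
              (fun i => pd i (fun y => ν y ⬝ᵥ e) x)
          * η x ^ 2 * √(gmat F x).det)
      ≤ 2 / |p| * ((ν x ⬝ᵥ e) ^ (p + 1)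
          * cometric F x (fun i => pd i η x) (fun i => pd i η x) * √(gmat F x).det)
        - ∑ i, (pd i (fun y => η y ^ 2) x * ((ν x ⬝ᵥ e) ^ p * normalFlux F ν e i x)
          + η x ^ 2 * pd i (fun y => (ν y ⬝ᵥ e) ^ p * normalFlux F ν e i y) x) := by
  set f := ν x ⬝ᵥ e
  set df : Fin n → ℝ := fun i => pd i (fun y => ν y ⬝ᵥ e) x
  set dη : Fin n → ℝ := fun i => pd i η x with hdη
  set s := √(gmat F x).det
  have hs : 0 < s := h.sqrt_det_pos hx
  have hfd : DifferentiableAt ℝ (fun y => ν y ⬝ᵥ e) x :=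
    (contDiffOn_dotProduct h.contDiffOn_normal
      contDiffOn_const).differentiableAt_of_isOpen h.isOpen hx
  have hrp : HasDerivAt (fun z : ℝ => z ^ p) (p * f ^ (p - 1)) f :=
    Real.hasDerivAt_rpow_const (Or.inl hf.ne')
  have hη2 (i : Fin n) : pd i (fun y => η y ^ 2) x = 2 * η x * dη i := by
    simp only [sq, pd_mul hη hη i, hdη]
    ring
  have hY (i : Fin n) : pd i (fun y => (ν y ⬝ᵥ e) ^ p * normalFlux F ν e i y) x
      = p * f ^ (p - 1) * df i * normalFlux F ν e i x
        + f ^ p * pd i (normalFlux F ν e i) x := by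
    rw [pd_mul (hfd.rpow_const (Or.inl hf.ne'))
      ((h.contDiffOn_normalFlux e i).differentiableAt_of_isOpen h.isOpen hx),
      pd_comp (φ := fun y => ν y ⬝ᵥ e) hrp hfd]
  have hdiv : ∑ i, (pd i (fun y => η y ^ 2) x * (f ^ p * normalFlux F ν e i x)
        + η x ^ 2 * pd i (fun y => (ν y ⬝ᵥ e) ^ p * normalFlux F ν e i y) x)
      = 2 * η x * f ^ p * (s * cometric F x dη df)
        + η x ^ 2 * (p * f ^ (p - 1)) * (s * cometric F x df df)
        + η x ^ 2 * f ^ p * (s * (∑ k, (e ⬝ᵥ coframe F k x) * pd k (meanH F ν) x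
          - normA2 F ν x * f)) := by
    rw [← h.sum_pd_normalFlux hx, ← h.sum_mul_normalFlux hx, ← h.sum_mul_normalFlux hx]
    simp only [Finset.mul_sum, ← Finset.sum_add_distrib, hη2, hY]
    exact Finset.sum_congr rfl fun i _ => by ring
  have hp1 : f ^ p = f ^ (p - 1) * f := by
    rw [← Real.rpow_add_one hf.ne', sub_add_cancel]
  have hp2 : f ^ (p + 1) = f ^ (p - 1) * f ^ 2 := by
    rw [Real.rpow_add_one hf.ne', hp1]
    ring
  have hr : 0 < f ^ (p - 1) := Real.rpow_pos_of_pos hf _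
  have hyoung := h.cometric_young hx dη df (2 * f) (-p * η x)
  have hq : 0 < -p := neg_pos.2 hp
  have hp0 := hp.ne
  rw [hdiv, hp2, hp1, abs_of_neg hp, ← sub_nonneg]
  generalize ∑ k, (e ⬝ᵥ coframe F k x) * pd k (meanH F ν) x = K at hH
  generalize cometric F x dη dη = a at hyoung ⊢
  generalize cometric F x dη df = b at hyoung ⊢
  generalize cometric F x df df = c at hyoung ⊢
  have hmain : 0 ≤ f ^ (p - 1) * s / (2 * -p)
        * ((2 * f) ^ 2 * a + (-p * η x) ^ 2 * c - 2 * (2 * f * (-p * η x)) * b)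
      + η x ^ 2 * (f ^ (p - 1) * f) * s * -K := by
    have := sub_nonneg.2 hyoung
    have := neg_nonneg.2 hH
    positivity
  convert! hmain using 1
  field_simp
  ring

end IsFramedHypersurface

end CotangentForm

/-- Test-function inequality for a hypersurface translating soliton
with `f = ⟨ν, e⟩ > 0` and `⟨∇_g H, e⟩ ≤ 0` on `Ω`. -/
theorem soliton_test_inequality {n : ℕ} (hn : 1 ≤ n)
    (Ω : Set (Fin n → ℝ)) (hΩo : IsOpen Ω) (hΩne : Ω.Nonempty)
    (F : (Fin n → ℝ) → (Fin (n + 1) → ℝ)) (hF : ContDiffOn ℝ (⊤ : ℕ∞) F Ω)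
    (himm : ∀ x ∈ Ω, (gmat F x).PosDef)
    (ν : (Fin n → ℝ) → (Fin (n + 1) → ℝ)) (hν : ContDiffOn ℝ (⊤ : ℕ∞) ν Ω)
    (hνunit : ∀ x ∈ Ω, ∑ a, (ν x a) ^ 2 = 1)
    (hνperp : ∀ x ∈ Ω, ∀ i, ∑ a, ν x a * pd i (fun y => F y a) x = 0)
    (W : Fin (n + 1) → ℝ) (hW : ∑ a, (W a) ^ 2 = 1)
    (hsol : ∀ x ∈ Ω, meanH F ν x = ∑ a, ν x a * W a)
    (e : Fin (n + 1) → ℝ) (he : ∑ a, (e a) ^ 2 = 1)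
    (hfpos : ∀ x ∈ Ω, 0 < ∑ a, ν x a * e a)
    (hgradH : ∀ x ∈ Ω,
      (∑ i, ∑ j, ginv F x i j * pd j (meanH F ν) x
        * ∑ a, pd i (fun y => F y a) x * e a) ≤ 0) :
    ∀ p : ℝ, p < 0 →
      ∀ η : (Fin n → ℝ) → ℝ, ContDiff ℝ (⊤ : ℕ∞) η → HasCompactSupport η → tsupport η ⊆ Ω →
        (∫ x in Ω, normA2 F ν x * (∑ a, ν x a * e a) ^ (p + 1) * η x ^ 2
            * Real.sqrt (gmat F x).det)
          + (|p| / 2) * ∫ x in Ω, (∑ a, ν x a * e a) ^ (p - 1)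
              * (∑ i, ∑ j, ginv F x i j * pd i (fun y => ∑ a, ν y a * e a) x
                  * pd j (fun y => ∑ a, ν y a * e a) x)
              * η x ^ 2 * Real.sqrt (gmat F x).det
        ≤ (2 / |p|) * ∫ x in Ω, (∑ a, ν x a * e a) ^ (p + 1)
            * (∑ i, ∑ j, ginv F x i j * pd i η x * pd j η x)
            * Real.sqrt (gmat F x).det := by
  intro p hp η hη hηc hηΩ
  have h : IsFramedHypersurface Ω F ν :=
    { isOpen := hΩo
      contDiffOn := hF
      contDiffOn_normal := hν
      posDef := himm
      normal_self := fun x hx => by simpa only [dotProduct, ← sq] using hνunit x hx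
      normal_tangent := hνperp }
  have hf : ContDiffOn ℝ (⊤ : ℕ∞) (fun y => ∑ a, ν y a * e a) Ω :=
    contDiffOn_dotProduct hν contDiffOn_const
  have hfr (q : ℝ) : ContDiffOn ℝ (⊤ : ℕ∞) (fun y => (∑ a, ν y a * e a) ^ q) Ω :=
    hf.rpow_const_of_ne fun x hx => (hfpos x hx).ne'
  have hη0 {x} (hx : x ∉ tsupport η) : η x = 0 := image_eq_zero_of_notMem_tsupport hx
  have hη2 : tsupport (fun y => η y ^ 2) ⊆ tsupport η :=
    closure_mono fun x hx hx' => hx (by simp [hx'])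
  obtain ⟨hDi, hD⟩ := setIntegral_divergence_eq_zero hΩo (hη.pow 2)
    (hηc.of_isClosed_subset (isClosed_tsupport _) hη2) (hη2.trans hηΩ)
    (fun i => (hfr p).mul (h.contDiffOn_normalFlux e i))
  have hA := (integrable_of_continuousOn_of_tsupport hηc hηΩ
    (((h.contDiffOn_normA2.mul (hfr (p + 1))).mul (hη.contDiffOn.pow 2)).mul
      h.contDiffOn_sqrt_det).continuousOn fun x hx => by simp [hη0 hx]).integrableOn (s := Ω)
  have hB := (integrable_of_continuousOn_of_tsupport hηc hηΩ
    ((((hfr (p - 1)).mul (h.contDiffOn_cometric (contDiffOn_pd hΩo hf)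
      (contDiffOn_pd hΩo hf))).mul (hη.contDiffOn.pow 2)).mul
      h.contDiffOn_sqrt_det).continuousOn fun x hx => by simp [hη0 hx]).integrableOn (s := Ω)
  have hC := (integrable_of_continuousOn_of_tsupport hηc hηΩ
    (((hfr (p + 1)).mul (h.contDiffOn_cometric (contDiffOn_pd hΩo hη.contDiffOn)
      (contDiffOn_pd hΩo hη.contDiffOn))).mul h.contDiffOn_sqrt_det).continuousOn
      fun x hx => by
        simp [cometric, pd_eq_zero_of_notMem_tsupport hx]).integrableOn (s := Ω)
  have hpt : ∀ x ∈ Ω, _ := fun x hx => h.test_inequality_pointwise hx (hfpos x hx) (by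
    refine (le_of_eq ?_).trans (hgradH x hx)
    rw [Finset.sum_comm]
    refine Finset.sum_congr rfl fun k _ => ?_
    rw [dotProduct_coframe, Finset.sum_mul]
    refine Finset.sum_congr rfl fun i _ => ?_
    rw [ginv_comm, dotProduct_comm, mul_right_comm]
    rfl) hp (hη.differentiable (by simp) x)
  have := setIntegral_mono_on (hA.add (hB.const_mul (|p| / 2)))
    ((hC.const_mul (2 / |p|)).sub hDi) hΩo.measurableSet hpt
  simp only [Pi.add_apply, Pi.sub_apply] at this
  rw [integral_add hA (hB.const_mul _), integral_sub (hC.const_mul _) hDi, hD, sub_zero,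
    integral_const_mul, integral_const_mul] at this
  exact this
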